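/- arXiv:0903.5504 — 3 statements merged into one kernel-verified Lean document; each statement's English description precedes it below -/
import Mathlib

section
/- For every real t < 6/7 there exists a smooth function φ : [0,2] → ℝ with φ(0) = φ(2) = 0, φ′(0) = 2, φ′(2) = −2, φ(τ) > 0 for all τ ∈ (0,2), such that for every τ ∈ [0,2] both −d/dτ[ ((1+τ)φ(τ))′/(2(1+τ)) ] ≥ t and 2 − ((1+τ)φ(τ))′/(2(1+τ)) ≥ t(1+τ) hold. -/
open Set

/-- The weighted slope `((1 + τ) φ)′ / (2 (1 + τ))` of the momentum profile `φ`, chosen as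
`1 - s τ - 2 (1 - s) (τ / 2) ^ (k + 2)`, which decreases from `1` at `0` to `-1` at `2` with
derivative at most `-s`. -/
noncomputable def weightedSlope (s : ℝ) (k : ℕ) (τ : ℝ) : ℝ :=
  1 - s * τ - 2 * (1 - s) * (τ / 2) ^ (k + 2)

/-- The primitive of `2 (1 + τ) * weightedSlope s k τ` vanishing at `0`. -/
noncomputable def weightedProfile (s : ℝ) (k : ℕ) (τ : ℝ) : ℝ :=
  2 * (τ + τ ^ 2 / 2 - s * (τ ^ 2 / 2 + τ ^ 3 / 3)
    - 2 * (1 - s) * (2 * (τ / 2) ^ (k + 3) / (k + 3) + 4 * (τ / 2) ^ (k + 4) / (k + 4)))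

theorem hasDerivAt_half_pow (n : ℕ) (τ : ℝ) :
    HasDerivAt (fun x : ℝ => (x / 2) ^ (n + 1)) ((n + 1) * (τ / 2) ^ n / 2) τ := by
  refine (((hasDerivAt_id' τ).div_const 2).fun_pow (n + 1)).congr_deriv ?_
  push_cast
  ring

theorem hasDerivAt_weightedSlope (s : ℝ) (k : ℕ) (τ : ℝ) :
    HasDerivAt (weightedSlope s k) (-s - (1 - s) * ((k + 2) * (τ / 2) ^ (k + 1))) τ := by
  have h := (((hasDerivAt_id' τ).const_mul s).const_sub 1).sub
    ((hasDerivAt_half_pow (k + 1) τ).const_mul (2 * (1 - s)))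
  refine h.congr_deriv ?_
  push_cast
  ring

theorem hasDerivAt_weightedProfile (s : ℝ) (k : ℕ) (τ : ℝ) :
    HasDerivAt (weightedProfile s k) (2 * (1 + τ) * weightedSlope s k τ) τ := by
  have h2 := (hasDerivAt_pow 2 τ).div_const 2
  have h3 := (hasDerivAt_pow 3 τ).div_const 3
  have hk3 := ((hasDerivAt_half_pow (k + 2) τ).const_mul 2).div_const ((k : ℝ) + 3)
  have hk4 := ((hasDerivAt_half_pow (k + 3) τ).const_mul 4).div_const ((k : ℝ) + 4)
  have h := ((((hasDerivAt_id' τ).add h2).sub ((h2.add h3).const_mul s)).sub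
    ((hk3.add hk4).const_mul (2 * (1 - s)))).const_mul 2
  refine h.congr_deriv ?_
  have e3 : (k : ℝ) + 3 ≠ 0 := by positivity
  have e4 : (k : ℝ) + 4 ≠ 0 := by positivity
  unfold weightedSlope
  have d3 : ((k + 2 : ℕ) : ℝ) + 1 = k + 3 := by push_cast; ring
  have d4 : ((k + 3 : ℕ) : ℝ) + 1 = k + 4 := by push_cast; ring
  rw [d3, d4]
  field_simp
  ring

theorem strictAntiOn_weightedSlope {s : ℝ} (hs : 0 < s) (hs1 : s ≤ 1) (k : ℕ) :
    StrictAntiOn (weightedSlope s k) (Ici 0) := by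
  intro a ha b _ hab
  have ha : 0 ≤ a := ha
  have hp : (a / 2) ^ (k + 2) ≤ (b / 2) ^ (k + 2) := by gcongr
  have := mul_le_mul_of_nonneg_left hp (by linarith : 0 ≤ 2 * (1 - s))
  have := mul_lt_mul_of_pos_left hab hs
  unfold weightedSlope
  linarith

theorem weightedProfile_pos {s : ℝ} (hs : 0 < s) (hs1 : s ≤ 1) {k : ℕ}
    (h2 : weightedProfile s k 2 = 0) {τ : ℝ} (hτ : τ ∈ Ioo (0 : ℝ) 2) :
    0 < weightedProfile s k τ := by
  have hanti := strictAntiOn_weightedSlope hs hs1 k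
  have hcont : Continuous (weightedProfile s k) :=
    continuous_iff_continuousAt.2 fun x => (hasDerivAt_weightedProfile s k x).continuousAt
  rcases le_or_gt 0 (weightedSlope s k τ) with hu | hu
  · have hmono : StrictMonoOn (weightedProfile s k) (Icc 0 τ) := by
      refine strictMonoOn_of_deriv_pos (convex_Icc 0 τ) hcont.continuousOn fun x hx => ?_
      rw [interior_Icc] at hx
      rw [(hasDerivAt_weightedProfile s k x).deriv]
      have := hanti hx.1.le hτ.1.le hx.2
      have := hx.1
      exact mul_pos (by linarith) (by linarith)
    have := hmono ⟨le_rfl, hτ.1.le⟩ ⟨hτ.1.le, le_rfl⟩ hτ.1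
    have h0 : weightedProfile s k 0 = 0 := by simp [weightedProfile]
    linarith
  · have hmono : StrictAntiOn (weightedProfile s k) (Icc τ 2) := by
      refine strictAntiOn_of_deriv_neg (convex_Icc τ 2) hcont.continuousOn fun x hx => ?_
      rw [interior_Icc] at hx
      rw [(hasDerivAt_weightedProfile s k x).deriv]
      have h0 : 0 < x := hτ.1.trans hx.1
      have := hanti hτ.1.le h0.le hx.1
      exact mul_neg_of_pos_of_neg (by linarith) (by linarith)
    have := hmono ⟨le_rfl, hτ.2.le⟩ ⟨hτ.2.le, le_rfl⟩ hτ.2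
    linarith

theorem exists_weightedProfile_two_eq_zero {t : ℝ} (ht : t < 6 / 7) :
    ∃ (s : ℝ) (k : ℕ), t ≤ s ∧ 0 < s ∧ s ≤ 1 ∧ weightedProfile s k 2 = 0 := by
  obtain ⟨k, hk⟩ := exists_nat_gt (6 * (1 - t) / (2 - 7 * t / 3))
  have hk0 : (0 : ℝ) ≤ k := k.cast_nonneg
  rw [div_lt_iff₀ (by linarith)] at hk
  obtain ⟨c, hc⟩ : ∃ c : ℝ, c = 2 / (k + 3) + 4 / (k + 4) := ⟨_, rfl⟩
  have hc6 : c * (k + 3) ≤ 6 := by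
    have : (4 : ℝ) / (k + 4) ≤ 4 / (k + 3) := by gcongr; norm_num
    have h3 : c ≤ 6 / (k + 3) := by
      rw [hc]
      calc _ ≤ (2 : ℝ) / (k + 3) + 4 / (k + 3) := by gcongr
        _ = _ := by ring
    rwa [le_div_iff₀ (by positivity)] at h3
  have hc0 : 0 < c := by rw [hc]; positivity
  have hc2 : c < 2 := by
    have : (2 : ℝ) / (k + 3) ≤ 2 / 3 := by gcongr; linarith
    have : (4 : ℝ) / (k + 4) ≤ 4 / 4 := by gcongr; linarith
    linarith
  have hct : c * (1 - t) ≤ 2 - 7 * t / 3 := by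
    have hpos : (0 : ℝ) < k + 3 := by positivity
    refine le_of_mul_le_mul_right ?_ hpos
    have := mul_le_mul_of_nonneg_right hc6 (by linarith : 0 ≤ 1 - t)
    nlinarith
  have hd : 0 < 7 / 3 - c := by linarith
  refine ⟨(2 - c) / (7 / 3 - c), k, ?_, div_pos (by linarith) hd, ?_, ?_⟩
  · rw [le_div_iff₀ hd]; linarith
  · rw [div_le_one hd]; linarith
  · have key : ∀ s : ℝ, weightedProfile s k 2 = 2 * (4 - 14 / 3 * s - 2 * (1 - s) * c) := by
      intro s
      simp only [weightedProfile, hc]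
      norm_num
      ring
    rw [key]
    linear_combination (-4) * div_mul_cancel₀ (2 - c) hd.ne'

theorem exists_momentum_profile_of_lt_six_sevenths (t : ℝ) (ht : t < 6 / 7) :
    ∃ φ : ℝ → ℝ, ContDiffOn ℝ (⊤ : ℕ∞) φ (Icc 0 2) ∧
      φ 0 = 0 ∧ φ 2 = 0 ∧
      derivWithin φ (Icc 0 2) 0 = 2 ∧ derivWithin φ (Icc 0 2) 2 = -2 ∧
      (∀ τ ∈ Ioo (0 : ℝ) 2, 0 < φ τ) ∧
      ∀ τ ∈ Icc (0 : ℝ) 2,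
        t ≤ - derivWithin
              (fun s : ℝ =>
                derivWithin (fun r : ℝ => (1 + r) * φ r) (Icc 0 2) s / (2 * (1 + s)))
              (Icc 0 2) τ ∧
        t * (1 + τ) ≤
          2 - derivWithin (fun r : ℝ => (1 + r) * φ r) (Icc 0 2) τ / (2 * (1 + τ)) := by
  obtain ⟨s, k, hts, hs, hs1, h2⟩ := exists_weightedProfile_two_eq_zero ht
  have h0 : weightedProfile s k 0 = 0 := by simp [weightedProfile]
  have huniq : UniqueDiffOn ℝ (Icc (0 : ℝ) 2) := uniqueDiffOn_Icc (by norm_num)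
  have hne : ∀ x ∈ Icc (0 : ℝ) 2, 1 + x ≠ 0 := fun x hx => by have := hx.1; positivity
  have hderiv : ∀ x ∈ Icc (0 : ℝ) 2, weightedProfile s k x = 0 →
      derivWithin (fun r => weightedProfile s k r / (1 + r)) (Icc 0 2) x
        = 2 * weightedSlope s k x := by
    intro x hx hx0
    have h := (hasDerivAt_weightedProfile s k x).fun_div ((hasDerivAt_id' x).const_add 1) (hne x hx)
    rw [h.hasDerivWithinAt.derivWithin (huniq x hx), hx0]
    have := hne x hx
    field_simp
    ring
  have hprim : ∀ x ∈ Icc (0 : ℝ) 2,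
      derivWithin (fun r => (1 + r) * (weightedProfile s k r / (1 + r))) (Icc 0 2) x
        / (2 * (1 + x)) = weightedSlope s k x := by
    intro x hx
    have hcongr : EqOn (fun r => (1 + r) * (weightedProfile s k r / (1 + r))) (weightedProfile s k)
        (Icc 0 2) := fun r hr => mul_div_cancel₀ _ (hne r hr)
    rw [derivWithin_congr hcongr (hcongr hx),
      (hasDerivAt_weightedProfile s k x).hasDerivWithinAt.derivWithin (huniq x hx)]
    exact mul_div_cancel_left₀ _ (mul_ne_zero two_ne_zero (hne x hx))
  have m0 : (0 : ℝ) ∈ Icc (0 : ℝ) 2 := by simp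
  have m2 : (2 : ℝ) ∈ Icc (0 : ℝ) 2 := by simp
  refine ⟨fun r => weightedProfile s k r / (1 + r), ?_, by simp [h0], by simp [h2], ?_, ?_, ?_, ?_⟩
  · refine ContDiffOn.div ?_ (by fun_prop) hne
    unfold weightedProfile
    fun_prop
  · rw [hderiv 0 m0 h0]; simp [weightedSlope]
  · rw [hderiv 2 m2 h2]; simp [weightedSlope]; ring
  · intro τ hτ
    exact div_pos (weightedProfile_pos hs hs1 h2 hτ) (by linarith [hτ.1])
  · intro τ hτ
    have hτ0 : 0 ≤ τ := hτ.1
    constructor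
    · rw [derivWithin_congr hprim (hprim τ hτ),
        (hasDerivAt_weightedSlope s k τ).hasDerivWithinAt.derivWithin (huniq τ hτ)]
      have : 0 ≤ (1 - s) * ((k + 2) * (τ / 2) ^ (k + 1)) :=
        mul_nonneg (by linarith) (by positivity)
      linarith
    · rw [hprim τ hτ]
      have : 0 ≤ 2 * (1 - s) * (τ / 2) ^ (k + 2) := mul_nonneg (by linarith) (by positivity)
      have := mul_le_mul_of_nonneg_right hts (by linarith : 0 ≤ 1 + τ)
      unfold weightedSlope
      linarith
end

section
/- Let t ∈ ℝ and let φ : [0,2] → ℝ be twice continuously differentiable with φ(0) = 0, φ(2) = 0, and φ′(0) = 2. If −d/dτ[ ((1+τ)φ(τ))′/(2(1+τ)) ] ≥ t for all τ ∈ [0,2], then t ≤ 6/7. -/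
open Set

/-- A function on an interval whose one-sided-at-the-endpoints derivative is nonpositive
is antitone. -/
theorem antitoneOn_Icc_of_hasDerivWithinAt_nonpos {f f' : ℝ → ℝ} {a b : ℝ}
    (hf : ∀ x ∈ Icc a b, HasDerivWithinAt f (f' x) (Icc a b) x)
    (hf' : ∀ x ∈ Icc a b, f' x ≤ 0) : AntitoneOn f (Icc a b) :=
  antitoneOn_of_hasDerivWithinAt_nonpos (convex_Icc a b)
    (fun x hx => (hf x hx).continuousWithinAt)
    (fun x hx => (hf x (interior_subset hx)).mono interior_subset)
    (fun x hx => hf' x (interior_subset hx))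

/-- Let `t ∈ ℝ` and let `φ : [0,2] → ℝ` be twice continuously differentiable with
`φ(0) = 0`, `φ(2) = 0`, and `φ′(0) = 2`.  If `−d/dτ[ ((1+τ)φ(τ))′/(2(1+τ)) ] ≥ t` for all
`τ ∈ [0,2]`, then `t ≤ 6/7`.  (Derivatives are taken within `[0,2]`.) -/
theorem six_sevenths_is_sharp (t : ℝ) (φ : ℝ → ℝ)
    (hφ : ContDiffOn ℝ 2 φ (Icc 0 2))
    (h0 : φ 0 = 0) (h2 : φ 2 = 0) (h0' : derivWithin φ (Icc 0 2) 0 = 2)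
    (hsecond : ∀ τ ∈ Icc (0 : ℝ) 2,
      t ≤ - derivWithin
            (fun s : ℝ =>
              derivWithin (fun r : ℝ => (1 + r) * φ r) (Icc 0 2) s / (2 * (1 + s)))
            (Icc 0 2) τ) :
    t ≤ 6 / 7 := by
  have hU : UniqueDiffOn ℝ (Icc (0 : ℝ) 2) := uniqueDiffOn_Icc (by norm_num)
  have m0 : (0 : ℝ) ∈ Icc (0 : ℝ) 2 := by norm_num
  have m2 : (2 : ℝ) ∈ Icc (0 : ℝ) 2 := by norm_num
  set u : ℝ → ℝ := fun r => (1 + r) * φ r with hu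
  have hu2 : ContDiffOn ℝ 2 u (Icc 0 2) := by fun_prop
  have hud : ∀ x ∈ Icc (0 : ℝ) 2,
      HasDerivWithinAt u (derivWithin u (Icc 0 2) x) (Icc 0 2) x := fun x hx =>
    (hu2.differentiableOn (by norm_num) x hx).hasDerivWithinAt
  have hu1 : ContDiffOn ℝ 1 (derivWithin u (Icc 0 2)) (Icc 0 2) :=
    hu2.derivWithin hU (by norm_num)
  have hu0 : derivWithin u (Icc 0 2) 0 = 2 := by
    have hφ0 := (hφ.differentiableOn (by norm_num) 0 m0).hasDerivWithinAt
    have h := (((hasDerivWithinAt_id (0 : ℝ) (Icc 0 2)).const_add 1).mul hφ0).derivWithin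
      (hU 0 m0)
    rw [h0'] at h
    refine Eq.trans h ?_
    simp [h0]
  set g : ℝ → ℝ := fun s => derivWithin u (Icc 0 2) s / (2 * (1 + s)) with hg
  have hgd : ∀ x ∈ Icc (0 : ℝ) 2,
      HasDerivWithinAt g (derivWithin g (Icc 0 2) x) (Icc 0 2) x := fun x hx => by
    have hx0 : 2 * (1 + x) ≠ 0 := by have := hx.1; positivity
    exact ((hu1.differentiableOn (by norm_num) x hx).div (by fun_prop) hx0).hasDerivWithinAt
  have hgle : ∀ x ∈ Icc (0 : ℝ) 2, g x ≤ 1 - t * x := fun x hx => by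
    have hanti := antitoneOn_Icc_of_hasDerivWithinAt_nonpos
      (fun y hy => (hgd y hy).add ((hasDerivWithinAt_id y (Icc 0 2)).const_mul t))
      (fun y hy => by linarith [hsecond y hy])
    have h := hanti m0 hx hx.1
    simp only [Pi.add_apply, id, hg, hu0] at h ⊢
    linarith
  have hule : ∀ x ∈ Icc (0 : ℝ) 2, derivWithin u (Icc 0 2) x ≤ (1 - t * x) * (2 * (1 + x)) :=
    fun x hx => (div_le_iff₀ (by linarith [hx.1])).1 (hgle x hx)
  have hp : ∀ x : ℝ, HasDerivAt (fun r : ℝ => 2 * r + (1 - t) * r ^ 2 - 2 * t / 3 * r ^ 3)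
      ((1 - t * x) * (2 * (1 + x))) x := fun x => by
    have h := (((hasDerivAt_id x).const_mul 2).add ((hasDerivAt_pow 2 x).const_mul (1 - t))).sub
      ((hasDerivAt_pow 3 x).const_mul (2 * t / 3))
    refine h.congr_deriv ?_
    norm_num
    ring
  have hanti := antitoneOn_Icc_of_hasDerivWithinAt_nonpos
    (fun y hy => (hud y hy).sub (hp y).hasDerivWithinAt)
    (fun y hy => sub_nonpos.2 (hule y hy))
  have h := hanti m0 m2 (by norm_num)
  simp only [Pi.sub_apply, hu, h0, h2] at h
  linarith
end

section
/- Let Q = {(x,y) ∈ ℝ² : 0 ≤ x ≤ 2, 0 ≤ y ≤ 2, and x + y ≤ 3} (the polygon with vertices (0,0), (2,0), (2,1), (1,2), (0,2)). Then the area of Q equals 7/2, the integral ∫_Q (−x−y) dμ equals −19/3 (where dμ is two-dimensional Lebesgue measure), and 2·∫_Q (−x−y) dμ − ( ∫_0^2 (−x) dx + ∫_0^1 (−(2+y)) dy + ∫_1^2 (−3) dx + ∫_0^1 (−(x+2)) dx + ∫_0^2 (−y) dy ) = −2/3. Consequently, for every real s one has s·(−2/3) + (1−s)·(7/2) = 7/2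 − (25/6)s, which is negative if and only if s > 21/25. -/
open MeasureTheory

/-- Fubini's theorem on the region between two graphs over an interval. -/
theorem setIntegral_between_graphs {a b : ℝ} (hab : a ≤ b) {g h : ℝ → ℝ}
    (hgh : ∀ x ∈ Set.Icc a b, g x ≤ h x) {S : Set (ℝ × ℝ)} (hS : MeasurableSet S)
    (hmem : ∀ p, p ∈ S ↔ p.1 ∈ Set.Icc a b ∧ p.2 ∈ Set.Icc (g p.1) (h p.1))
    {f : ℝ × ℝ → ℝ} (hf : IntegrableOn f S) :
    ∫ p in S, f p = ∫ x in a..b, ∫ y in (g x)..(h x), f (x, y) := by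
  rw [← integral_indicator hS, Measure.volume_eq_prod,
    integral_prod _ (by rwa [← Measure.volume_eq_prod, integrable_indicator_iff hS]),
    intervalIntegral.integral_of_le hab, ← integral_Icc_eq_integral_Ioc,
    ← integral_indicator measurableSet_Icc]
  refine integral_congr_ae (ae_of_all _ fun x => ?_)
  by_cases hx : x ∈ Set.Icc a b
  · simp only [Set.indicator_of_mem hx]
    rw [intervalIntegral.integral_of_le (hgh x hx), ← integral_Icc_eq_integral_Ioc,
      ← integral_indicator measurableSet_Icc]
    refine integral_congr_ae (ae_of_all _ fun y => ?_)
    beta_reduce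
    by_cases hy : y ∈ Set.Icc (g x) (h x)
    · rw [Set.indicator_of_mem ((hmem (x, y)).2 ⟨hx, hy⟩), Set.indicator_of_mem hy]
    · rw [Set.indicator_of_notMem fun hp => hy ((hmem (x, y)).1 hp).2,
        Set.indicator_of_notMem hy]
  · rw [Set.indicator_of_notMem hx]
    have hzero (y : ℝ) : S.indicator f (x, y) = 0 :=
      Set.indicator_of_notMem (fun hp => hx ((hmem (x, y)).1 hp).1) f
    simp only [hzero, integral_zero]

/-- Integration over the square `[0,2]²` with the corner `x + y > 3` cut off. -/
theorem setIntegral_cut_square {Q : Set (ℝ × ℝ)} (hQc : IsCompact Q)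
    (hQ : Q = {p : ℝ × ℝ | 0 ≤ p.1 ∧ p.1 ≤ 2 ∧ 0 ≤ p.2 ∧ p.2 ≤ 2 ∧ p.1 + p.2 ≤ 3})
    {f : ℝ × ℝ → ℝ} (hf : Continuous f) :
    ∫ p in Q, f p = (∫ x in (0:ℝ)..1, ∫ y in (0:ℝ)..2, f (x, y))
      + ∫ x in (1:ℝ)..2, ∫ y in (0:ℝ)..(3 - x), f (x, y) := by
  have hcont : Continuous fun x : ℝ => ∫ y in (0:ℝ)..(min 2 (3 - x)), f (x, y) :=
    intervalIntegral.continuous_parametric_intervalIntegral_of_continuous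
      (f := fun x y => f (x, y)) (by exact hf) (by fun_prop)
  rw [setIntegral_between_graphs (a := 0) (b := 2) (g := fun _ => 0)
      (h := fun x => min 2 (3 - x)) (by norm_num) ?_ hQc.measurableSet ?_
      (hf.continuousOn.integrableOn_compact hQc),
    ← intervalIntegral.integral_add_adjacent_intervals (b := 1)
      (hcont.intervalIntegrable _ _) (hcont.intervalIntegrable _ _)]
  · congr 1
    · refine intervalIntegral.integral_congr fun x hx => ?_
      rw [Set.uIcc_of_le (by norm_num)] at hx
      simp only [min_eq_left (show (2:ℝ) ≤ 3 - x by linarith [hx.2])]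
    · refine intervalIntegral.integral_congr fun x hx => ?_
      rw [Set.uIcc_of_le (by norm_num)] at hx
      simp only [min_eq_right (show 3 - x ≤ (2:ℝ) by linarith [hx.1])]
  · intro x hx
    exact le_min (by norm_num) (by linarith [hx.2])
  · intro p
    simp only [hQ, Set.mem_ofPred_eq, Set.mem_Icc, le_min_iff, le_sub_iff_add_le']
    tauto

/-- Let `Q = {(x,y) : 0 ≤ x ≤ 2, 0 ≤ y ≤ 2, x + y ≤ 3}` (the polygon with vertices
`(0,0), (2,0), (2,1), (1,2), (0,2)`, the moment polytope of `P²` blown up at two points).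
Then the area of `Q` is `7/2`, `∫_Q (−x−y) dμ = −19/3`, and
`2∫_Q (−x−y) dμ − (∫₀² (−x) dx + ∫₀¹ (−(2+y)) dy + ∫₁² (−3) dx + ∫₀¹ (−(x+2)) dx +
∫₀² (−y) dy) = −2/3`.  Consequently, for every real `s`,
`s·(−2/3) + (1−s)·(7/2) = 7/2 − (25/6)s`, which is negative iff `s > 21/25`. -/
theorem futaki_computation_two_point_blowup
    (Q : Set (ℝ × ℝ))
    (hQ : Q = {p : ℝ × ℝ | 0 ≤ p.1 ∧ p.1 ≤ 2 ∧ 0 ≤ p.2 ∧ p.2 ≤ 2 ∧ p.1 + p.2 ≤ 3}) :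
    volume Q = ENNReal.ofReal (7 / 2) ∧
    (∫ p in Q, (-p.1 - p.2) ∂volume) = -19 / 3 ∧
    2 * (∫ p in Q, (-p.1 - p.2) ∂volume)
      - ((∫ x in (0:ℝ)..2, -x) + (∫ y in (0:ℝ)..1, -(2 + y)) + (∫ _x in (1:ℝ)..2, (-3 : ℝ))
          + (∫ x in (0:ℝ)..1, -(x + 2)) + (∫ y in (0:ℝ)..2, -y))
      = -2 / 3 ∧
    ∀ s : ℝ, s * (-2 / 3) + (1 - s) * (7 / 2) = 7 / 2 - (25 / 6) * s ∧
      (7 / 2 - (25 / 6) * s < 0 ↔ 21 / 25 < s) := by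
  have hQc : IsCompact Q := by
    refine (isCompact_Icc (a := ((0, 0) : ℝ × ℝ)) (b := (2, 2))).of_isClosed_subset ?_ ?_
    · rw [hQ]
      exact (isClosed_le (by fun_prop) (by fun_prop)).and
        ((isClosed_le (by fun_prop) (by fun_prop)).and
        ((isClosed_le (by fun_prop) (by fun_prop)).and
        ((isClosed_le (by fun_prop) (by fun_prop)).and
        (isClosed_le (by fun_prop) (by fun_prop)))))
    · rw [hQ]
      rintro p ⟨h₁, h₂, h₃, h₄, -⟩
      exact ⟨⟨h₁, h₃⟩, ⟨h₂, h₄⟩⟩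
  have hvol : volume.real Q = 7 / 2 := by
    have h := setIntegral_cut_square hQc hQ (f := fun _ => 1) continuous_const
    rw [setIntegral_const] at h
    simp only [smul_eq_mul, mul_one, intervalIntegral.integral_const] at h
    rw [h]
    simp only [sub_zero]
    rw [intervalIntegral.integral_sub (by simp) (by simp)]
    norm_num
  have hint : ∫ p in Q, (-p.1 - p.2) = -19 / 3 := by
    have inner (x c : ℝ) : ∫ y in (0:ℝ)..c, (-x - y) = -x * c - c ^ 2 / 2 := by
      rw [intervalIntegral.integral_sub (by simp) (by simp)]
      simp
      ring
    have outer (x : ℝ) : -x * (3 - x) - (3 - x) ^ 2 / 2 = x ^ 2 / 2 - 9 / 2 := by ring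
    rw [setIntegral_cut_square hQc hQ (by fun_prop)]
    simp only [inner, outer]
    rw [intervalIntegral.integral_sub (Continuous.intervalIntegrable (by fun_prop) _ _) (by simp),
      intervalIntegral.integral_sub (Continuous.intervalIntegrable (by fun_prop) _ _) (by simp)]
    simp
    norm_num
  refine ⟨?_, hint, ?_, fun s => ⟨by ring, ?_⟩⟩
  · rw [← hvol, ofReal_measureReal hQc.measure_ne_top]
  · rw [hint]
    have hadd (c : ℝ) : ∫ y in (0:ℝ)..1, (c + y) = c + 1 / 2 := by
      rw [intervalIntegral.integral_add (by simp) (by simp)]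
      simp
    have hneg : ∫ x in (0:ℝ)..2, -x = -2 := by
      rw [intervalIntegral.integral_neg, integral_id]
      norm_num
    simp only [hneg, intervalIntegral.integral_neg, add_comm _ (2:ℝ), hadd,
      intervalIntegral.integral_const, smul_eq_mul]
    norm_num
  · constructor <;> intro h <;> linarith
end
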